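/- Let d ≥ 3 be an odd integer, r ∈ F_q^*, and let m ∈ F_q^d be a nonzero vector. Then Σ_{t ∈ F_q} |S_t|·Ŝ_{rt}(m) = q^{(−d−3)/2}·G^{d+1}·η(r·(−1)^{(d+1)/2})·(−1 + Σ_{s ∈ F_q} χ(s·||m||)). -/

import Mathlib

open Finset

def nrm {F : Type} [Field F] {d : ℕ} (x : Fin d → F) : F := ∑ i, x i ^ 2

noncomputable def ft {F : Type} [Field F] [Fintype F] (d : ℕ) (χ : AddChar F ℂ)
    (f : (Fin d → F) → ℂ) (m : Fin d → F) : ℂ :=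
  (Fintype.card F : ℂ) ^ (-(d : ℤ)) * ∑ x : Fin d → F, χ (-(∑ i, x i * m i)) * f x

noncomputable def sphereFT {F : Type} [Field F] [Fintype F] [DecidableEq F] (d : ℕ)
    (χ : AddChar F ℂ) (t : F) (m : Fin d → F) : ℂ :=
  ft d χ (fun x => if nrm x = t then 1 else 0) m

noncomputable def eta (F : Type) [Field F] [Fintype F] [DecidableEq F] (s : F) : ℂ :=
  ((quadraticChar F s : ℤ) : ℂ)

noncomputable def gSum (F : Type) [Field F] [Fintype F] [DecidableEq F] (χ : AddChar F ℂ) : ℂ :=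
  ∑ s ∈ Finset.univ.filter (fun s : F => s ≠ 0), eta F s * χ s

def nu {F : Type} [Field F] [Fintype F] [DecidableEq F] {d : ℕ}
    (E : Finset (Fin d → F)) (t : F) : ℕ :=
  ((E ×ˢ E).filter (fun p => nrm (p.1 - p.2) = t)).card

def distSet {F : Type} [Field F] {d : ℕ} (E : Finset (Fin d → F)) : Set F :=
  {t | ∃ x ∈ E, ∃ y ∈ E, nrm (x - y) = t}

def quotSet {F : Type} [Field F] {d : ℕ} (E : Finset (Fin d → F)) : Set F :=
  {r | ∃ a ∈ distSet E, ∃ b ∈ distSet E, b ≠ 0 ∧ r = a / b}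

def sphereCard (F : Type) [Field F] [Fintype F] [DecidableEq F] (d : ℕ) (t : F) : ℕ :=
  (Finset.univ.filter (fun x : Fin d → F => nrm x = t)).card

theorem AddChar.map_finset_sum {F ι : Type*} [Field F] (χ : AddChar F ℂ) (s : Finset ι)
    (f : ι → F) :
    χ (∑ i ∈ s, f i) = ∏ i ∈ s, χ (f i) := by
  classical
  induction s using Finset.induction_on with
  | empty => simp
  | insert a s ha ih => rw [sum_insert ha, prod_insert ha, AddChar.map_add_eq_mul, ih]

section QuadraticGaussSums

variable {F : Type} [Field F] [Fintype F]

theorem AddChar.sum_mul_left_eq_zero {χ : AddChar F ℂ} (hχ : χ ≠ 1) {a : F} (ha : a ≠ 0) :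
    ∑ x : F, χ (a * x) = 0 := by
  classical
  have h := AddChar.sum_mulShift a (AddChar.IsPrimitive.of_ne_one hχ)
  simpa [ha, mul_comm] using h

theorem AddChar.card_mul_ite_eq [DecidableEq F] {χ : AddChar F ℂ} (hχ : χ ≠ 1) (a b : F) :
    (Fintype.card F : ℂ) * (if a = b then 1 else 0) = ∑ s : F, χ (s * (a - b)) := by
  rw [AddChar.sum_mulShift _ (AddChar.IsPrimitive.of_ne_one hχ)]
  by_cases h : a = b <;> simp [h, sub_eq_zero]

theorem sum_addChar_sub_dot (χ : AddChar F ℂ) {d : ℕ} (s : F) (m : Fin d → F) :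
    ∑ x : Fin d → F, χ (s * nrm x - ∑ i, x i * m i)
      = ∏ i, ∑ y : F, χ (s * y ^ 2 - y * m i) := by
  rw [Fintype.prod_sum]
  refine sum_congr rfl fun x _ => ?_
  rw [nrm, mul_sum, ← sum_sub_distrib, AddChar.map_finset_sum]

theorem sum_addChar_neg_dot_eq_zero {χ : AddChar F ℂ} (hχ : χ ≠ 1) {d : ℕ} {m : Fin d → F}
    (hm : m ≠ 0) : ∑ x : Fin d → F, χ (0 * nrm x - ∑ i, x i * m i) = 0 := by
  obtain ⟨i, hi⟩ := Function.ne_iff.mp hm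
  rw [sum_addChar_sub_dot]
  refine prod_eq_zero (mem_univ i) ?_
  have h := AddChar.sum_mul_left_eq_zero hχ (neg_ne_zero.mpr hi)
  simpa [mul_comm] using h

variable [DecidableEq F]

theorem eta_mul (a b : F) : eta F (a * b) = eta F a * eta F b := by
  simp only [eta, map_mul, Int.cast_mul]

theorem eta_pow (a : F) (n : ℕ) : eta F (a ^ n) = eta F a ^ n := by
  simp only [eta, map_pow, Int.cast_pow]

theorem eta_sq {a : F} (ha : a ≠ 0) : eta F a ^ 2 = 1 := by
  have h := quadraticChar_sq_one ha
  rw [eta]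
  exact_mod_cast h

theorem gSum_eq_sum (χ : AddChar F ℂ) : gSum F χ = ∑ s : F, eta F s * χ s := by
  rw [gSum, sum_filter]
  refine sum_congr rfl fun s _ => ?_
  by_cases h : s = 0 <;> simp [h, eta]

theorem gSum_sq (hF : ringChar F ≠ 2) {χ : AddChar F ℂ} (hχ : χ ≠ 1) :
    gSum F χ ^ 2 = eta F (-1) * Fintype.card F := by
  have hinj : Function.Injective (Int.castRingHom ℂ) := Int.cast_injective
  have h := gaussSum_sq (χ := (quadraticChar F).ringHomComp (Int.castRingHom ℂ))
    ((MulChar.ringHomComp_ne_one_iff hinj).mpr (quadraticChar_ne_one hF))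
    ((quadraticChar_isQuadratic F).comp _) (AddChar.IsPrimitive.of_ne_one hχ)
  rw [gSum_eq_sum]
  simpa [gaussSum, eta] using h

theorem sum_eta_mul_addChar (χ : AddChar F ℂ) {a : F} (ha : a ≠ 0) :
    ∑ x : F, eta F x * χ (a * x) = eta F a * gSum F χ := by
  rw [gSum_eq_sum, ← Equiv.sum_comp (Equiv.mulLeft₀ a ha) (fun s => eta F s * χ s), mul_sum]
  refine sum_congr rfl fun x _ => ?_
  simp only [Equiv.mulLeft₀_apply, eta_mul]
  linear_combination (-(eta F x * χ (a * x))) * eta_sq ha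

theorem sum_comp_sq (hF : ringChar F ≠ 2) (f : F → ℂ) :
    ∑ x : F, f (x ^ 2) = ∑ y : F, (eta F y + 1) * f y := by
  rw [← sum_fiberwise (s := univ) (g := fun x : F => x ^ 2)]
  refine sum_congr rfl fun y _ => ?_
  have h := quadraticChar_card_sqrts hF y
  rw [sum_congr rfl (g := fun _ => f y) (by simp +contextual), sum_const, nsmul_eq_mul]
  congr 1
  rw [eta]
  have h' : (({x : F | x ^ 2 = y} : Finset F).card : ℤ) = quadraticChar F y + 1 := by
    rw [← h]
    congr 2
    ext
    simp
  exact_mod_cast h'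

theorem sum_addChar_mul_sq (hF : ringChar F ≠ 2) {χ : AddChar F ℂ} (hχ : χ ≠ 1) {a : F}
    (ha : a ≠ 0) : ∑ x : F, χ (a * x ^ 2) = eta F a * gSum F χ := by
  rw [sum_comp_sq hF (fun y => χ (a * y))]
  simp only [add_mul, one_mul, sum_add_distrib]
  rw [sum_eta_mul_addChar χ ha, AddChar.sum_mul_left_eq_zero hχ ha, add_zero]

theorem sum_addChar_quadratic (hF : ringChar F ≠ 2) {χ : AddChar F ℂ} (hχ : χ ≠ 1) {a : F}
    (ha : a ≠ 0) (b : F) :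
    ∑ x : F, χ (a * x ^ 2 - x * b) = eta F a * gSum F χ * χ (-(4 * a)⁻¹ * b ^ 2) := by
  have h2 : (2 : F) ≠ 0 := Ring.two_ne_zero hF
  have h4 : (4 : F) ≠ 0 := by
    rw [show (4 : F) = 2 * 2 by norm_num]
    exact mul_ne_zero h2 h2
  rw [← sum_addChar_mul_sq hF hχ ha, sum_mul,
    ← Equiv.sum_comp (Equiv.addRight (b / (2 * a)))]
  refine sum_congr rfl fun x _ => ?_
  rw [← AddChar.map_add_eq_mul, Equiv.coe_addRight]
  congr 1
  field_simp
  ring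

theorem sum_addChar_nrm_sub_dot (hF : ringChar F ≠ 2) {χ : AddChar F ℂ} (hχ : χ ≠ 1) {d : ℕ}
    {s : F} (hs : s ≠ 0) (m : Fin d → F) :
    ∑ x : Fin d → F, χ (s * nrm x - ∑ i, x i * m i)
      = (eta F s * gSum F χ) ^ d * χ (-(4 * s)⁻¹ * nrm m) := by
  rw [sum_addChar_sub_dot]
  simp only [sum_addChar_quadratic hF hχ hs]
  rw [prod_mul_distrib, ← AddChar.map_finset_sum, ← mul_sum, nrm]
  simp

theorem sum_addChar_nrm (hF : ringChar F ≠ 2) {χ : AddChar F ℂ} (hχ : χ ≠ 1) {d : ℕ}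
    {s : F} (hs : s ≠ 0) :
    ∑ x : Fin d → F, χ (s * nrm x) = (eta F s * gSum F χ) ^ d := by
  simpa [nrm] using sum_addChar_nrm_sub_dot hF hχ hs (0 : Fin d → F)

theorem card_mul_sphereFT {χ : AddChar F ℂ} (hχ : χ ≠ 1) (d : ℕ) (t : F) (m : Fin d → F) :
    (Fintype.card F : ℂ) * sphereFT d χ t m = (Fintype.card F : ℂ) ^ (-(d : ℤ)) *
      ∑ s : F, χ (-s * t) * ∑ x : Fin d → F, χ (s * nrm x - ∑ i, x i * m i) := by
  rw [sphereFT, ft, mul_left_comm]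
  congr 1
  simp only [mul_sum]
  rw [sum_comm]
  refine sum_congr rfl fun x _ => ?_
  rw [mul_left_comm, AddChar.card_mul_ite_eq hχ, mul_sum]
  refine sum_congr rfl fun s _ => ?_
  rw [← AddChar.map_add_eq_mul, ← AddChar.map_add_eq_mul]
  congr 1
  ring

theorem sum_sphereCard_mul (d : ℕ) (f : F → ℂ) :
    ∑ t : F, (sphereCard F d t : ℂ) * f t = ∑ y : Fin d → F, f (nrm y) := by
  rw [← sum_fiberwise (s := univ) (g := fun y : Fin d → F => nrm y)]
  refine sum_congr rfl fun t _ => ?_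
  rw [sum_congr rfl (g := fun _ => f t) (by simp +contextual), sum_const, nsmul_eq_mul, sphereCard]

theorem sum_ite_addChar_neg_inv_mul (hF : ringChar F ≠ 2) (χ : AddChar F ℂ) (c : F) :
    ∑ s : F, (if s = 0 then 0 else χ (-(4 * s)⁻¹ * c)) = -1 + ∑ s : F, χ (s * c) := by
  have h2 : (2 : F) ≠ 0 := Ring.two_ne_zero hF
  have h4 : (-4 : F) ≠ 0 := by
    rw [show (-4 : F) = -(2 * 2) by norm_num]
    exact neg_ne_zero.mpr (mul_ne_zero h2 h2)
  rw [← Equiv.sum_comp ((Equiv.mulLeft₀ (-4 : F) h4).trans (Equiv.inv F)) (fun s => χ (s * c))]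
  have h : ∀ s : F, (if s = 0 then 0 else χ (-(4 * s)⁻¹ * c))
      = χ (-(4 * s)⁻¹ * c) - if s = 0 then 1 else 0 := by
    intro s
    by_cases hs : s = 0 <;> simp [hs]
  simp only [h, sum_sub_distrib, sum_ite_eq', mem_univ, if_true]
  rw [neg_add_eq_sub]
  congr 1
  refine sum_congr rfl fun s _ => ?_
  simp

theorem card_mul_sum_sphereCard_mul_sphereFT (hF : ringChar F ≠ 2) {χ : AddChar F ℂ}
    (hχ : χ ≠ 1) {d : ℕ} {r : F} (hr : r ≠ 0) {m : Fin d → F} (hm : m ≠ 0) :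
    (Fintype.card F : ℂ) * ∑ t : F, (sphereCard F d t : ℂ) * sphereFT d χ (r * t) m
      = (Fintype.card F : ℂ) ^ (-(d : ℤ)) * (gSum F χ ^ (2 * d) * eta F (-r) ^ d
          * (-1 + ∑ s : F, χ (s * nrm m))) := by
  rw [sum_sphereCard_mul d (fun t => sphereFT d χ (r * t) m), mul_sum]
  simp only [card_mul_sphereFT hχ]
  rw [← mul_sum, sum_comm, ← sum_ite_addChar_neg_inv_mul hF,
    mul_sum univ _ (gSum F χ ^ (2 * d) * eta F (-r) ^ d)]
  congr 1
  refine sum_congr rfl fun s _ => ?_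
  rw [← sum_mul]
  by_cases hs : s = 0
  · rw [hs, sum_addChar_neg_dot_eq_zero hχ hm]
    simp
  · have hsr : -s * r ≠ 0 := mul_ne_zero (neg_ne_zero.mpr hs) hr
    simp only [← mul_assoc (-s) r]
    rw [sum_addChar_nrm hF hχ hsr, sum_addChar_nrm_sub_dot hF hχ hs, if_neg hs,
      show -s * r = s * -r by ring, eta_mul]
    have h1 : (eta F s ^ 2) ^ d = 1 := by rw [eta_sq hs, one_pow]
    linear_combination (gSum F χ ^ (2 * d) * eta F (-r) ^ d * χ (-(4 * s)⁻¹ * nrm m)) * h1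

end QuadraticGaussSums

theorem sum_sphereCard_sphereFT_odd (F : Type) [Field F] [Fintype F] [DecidableEq F]
    (hq : Odd (Fintype.card F)) (d : ℕ) (hd : 3 ≤ d) (hdo : Odd d)
    (χ : AddChar F ℂ) (hχ : χ ≠ 1) (r : F) (hr : r ≠ 0)
    (m : Fin d → F) (hm : m ≠ 0) :
    ∑ t : F, (sphereCard F d t : ℂ) * sphereFT d χ (r * t) m
      = (Fintype.card F : ℂ) ^ ((-(d : ℤ) - 3) / 2) * (gSum F χ) ^ (d + 1)
          * eta F (r * (-1 : F) ^ ((d + 1) / 2))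
          * (-1 + ∑ s : F, χ (s * nrm m)) := by
  have hF : ringChar F ≠ 2 := by
    rw [Ne, FiniteField.even_card_iff_char_two]
    have := Nat.odd_iff.mp hq
    omega
  have hq0 : (Fintype.card F : ℂ) ≠ 0 := Nat.cast_ne_zero.mpr Fintype.card_ne_zero
  refine mul_left_cancel₀ hq0 ?_
  rw [card_mul_sum_sphereCard_mul_sphereFT hF hχ hr hm]
  obtain ⟨k, rfl⟩ := hdo
  have he : (-((2 * k + 1 : ℕ) : ℤ) - 3) / 2 = -(k : ℤ) - 2 := by
    push_cast
    omega
  have hk : (2 * k + 1 + 1) / 2 = k + 1 := by omega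
  have hG : gSum F χ ^ (2 * (2 * k + 1))
      = gSum F χ ^ (2 * k + 1 + 1) * (eta F (-1) * Fintype.card F) ^ k := by
    rw [← gSum_sq hF hχ]
    ring
  have hη : eta F (-r) ^ (2 * k + 1) = eta F (-1) * eta F r := by
    rw [pow_succ, pow_mul, eta_sq (neg_ne_zero.mpr hr), one_pow, one_mul, ← eta_mul, neg_one_mul]
  have hpow : (Fintype.card F : ℂ) ^ (-((2 * k + 1 : ℕ) : ℤ)) * (Fintype.card F : ℂ) ^ k
      = Fintype.card F * (Fintype.card F : ℂ) ^ (-(k : ℤ) - 2) := by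
    rw [← zpow_natCast _ k, ← zpow_add₀ hq0, ← zpow_one_add₀ hq0]
    congr 1
    push_cast
    ring
  rw [he, hk, hG, hη, eta_mul, eta_pow]
  linear_combination (gSum F χ ^ (2 * k + 1 + 1) * eta F (-1) ^ (k + 1) * eta F r
    * (-1 + ∑ s : F, χ (s * nrm m))) * hpow
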